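/- Let K be an algebraically closed field of characteristic 0, let n ≥ 2, k ≥ 1, and 1 ≤ s ≤ 3 with s ≤ n. Let t : ℕ → ℕ be given by t(i) = i+1 for 0 ≤ i ≤ n−1, t(j) = s for n ≤ j ≤ n+k, and t(j) = 0 for j > n+k. Then there exist finitely many homogeneous ideals J_1, …, J_m of K[x,y] such that every homogeneous ideal I of K[x,y] with t_I = t satisfies φ(I) = J_i for some linear change of variables φ and some i. -/

import Mathlib

open MvPolynomial

noncomputable section

/-- The polynomial ring `K[x,y]`. -/
abbrev Pxy (K : Type*) [Field K] := MvPolynomial (Fin 2) K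

/-- An ideal of `K[x,y]` is homogeneous if it contains all homogeneous
components of each of its elements. -/
def IsHomog {K : Type*} [Field K] (I : Ideal (Pxy K)) : Prop :=
  ∀ f ∈ I, ∀ k : ℕ, homogeneousComponent k f ∈ I

/-- The Hilbert function of an ideal:
`t_I(k) = dim_K (K[x,y]_k / (I ∩ K[x,y]_k))`. -/
def hilb (K : Type*) [Field K] (I : Ideal (Pxy K)) (k : ℕ) : ℕ :=
  Module.finrank K
    (homogeneousSubmodule (Fin 2) K k ⧸
      Submodule.comap (homogeneousSubmodule (Fin 2) K k).subtype (I.restrictScalars K))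

/-- A linear change of variables: a `K`-algebra automorphism sending the
variables to homogeneous polynomials of degree 1. -/
def IsLinChange {K : Type*} [Field K] (φ : Pxy K ≃ₐ[K] Pxy K) : Prop :=
  ∀ i : Fin 2, (φ (X i)).IsHomogeneous 1

/-- `t` is of homogeneous finite type: there are finitely many homogeneous ideals
`J₁, …, Jₘ` such that every homogeneous ideal `I` with Hilbert function `t` is
mapped onto some `Jᵢ` by a linear change of variables. -/
def HomogFiniteType (K : Type*) [Field K] (t : ℕ → ℕ) : Prop :=
  ∃ S : Set (Ideal (Pxy K)), S.Finite ∧ (∀ J ∈ S, IsHomog J) ∧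
    ∀ I : Ideal (Pxy K), IsHomog I → (∀ k, hilb K I k = t k) →
      ∃ φ : Pxy K ≃ₐ[K] Pxy K, IsLinChange φ ∧ Ideal.map φ I ∈ S

open Module

theorem finrank_homogeneousSubmodule (K : Type*) [Field K] (j : ℕ) :
    finrank K (homogeneousSubmodule (Fin 2) K j) = j + 1 := by
  have hset : {d : Fin 2 →₀ ℕ | d.degree = j} =
      ((Finset.univ : Finset (Fin 2)).finsuppAntidiag j : Set (Fin 2 →₀ ℕ)) := by
    ext d
    simp [Finset.mem_finsuppAntidiag, Finsupp.degree_eq_sum]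
  have h : homogeneousSubmodule (Fin 2) K j =
      restrictSupport K ((Finset.univ : Finset (Fin 2)).finsuppAntidiag j : Set (Fin 2 →₀ ℕ)) := by
    rw [homogeneousSubmodule_eq_finsupp_supported, hset]; rfl
  rw [h, finrank_eq_card_basis (basisRestrictSupport K _)]
  simp [Finset.card_finsuppAntidiag_nat_eq_choose, add_comm 1 j]

instance finiteDimensional_homogeneousSubmodule (K : Type*) [Field K] (j : ℕ) :
    FiniteDimensional K (homogeneousSubmodule (Fin 2) K j) :=
  Module.Finite.iff_fg.mpr (homogeneousSubmodule_fg _ _ j)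

theorem homogeneousSubmodule_succ (K : Type*) [Field K] (j : ℕ) :
    homogeneousSubmodule (Fin 2) K (j + 1) =
      (homogeneousSubmodule (Fin 2) K j).map (LinearMap.mulLeft K (X 0)) ⊔
      (homogeneousSubmodule (Fin 2) K j).map (LinearMap.mulLeft K (X 1)) := by
  apply le_antisymm
  · rw [← homogeneousSubmodule_one_pow _ (j + 1), pow_succ', homogeneousSubmodule_one_pow,
      homogeneousSubmodule_one_eq_span_X, Submodule.mul_le]
    intro m hm p hp
    have : Set.range (X : Fin 2 → Pxy K) = {X 0, X 1} := by
      ext q; simp [eq_comm]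
    rw [this, Submodule.mem_span_pair] at hm
    obtain ⟨a, b, rfl⟩ := hm
    rw [Submodule.mem_sup]
    refine ⟨_, ⟨a • p, Submodule.smul_mem _ a hp, rfl⟩, _,
      ⟨b • p, Submodule.smul_mem _ b hp, rfl⟩, ?_⟩
    simp [add_mul]
  · rw [sup_le_iff]
    constructor <;>
    · rintro _ ⟨p, hp, rfl⟩
      rw [add_comm]
      exact (isHomogeneous_X K _).mul hp

theorem finrank_map_mulLeft {K : Type*} [Field K] {f : Pxy K} (hf : f ≠ 0)
    (V : Submodule K (Pxy K)) :
    finrank K (V.map (LinearMap.mulLeft K f)) = finrank K V :=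
  (LinearEquiv.finrank_eq (V.equivMapOfInjective _ (mul_right_injective₀ hf))).symm

theorem exists_eq_C_of_isHomogeneous_zero {K : Type*} [Field K] {f : Pxy K}
    (hf : f.IsHomogeneous 0) : ∃ c, f = C c := by
  have h : f ∈ homogeneousSubmodule (Fin 2) K 0 := hf
  rw [homogeneousSubmodule_zero] at h
  obtain ⟨c, rfl⟩ := Submodule.mem_one.mp h
  exact ⟨c, rfl⟩

theorem Submodule.exists_le_finrank_eq {K M : Type*} [Field K] [AddCommGroup M] [Module K M]
    (W : Submodule K M) {d : ℕ} (hd : d ≤ finrank K W) :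
    ∃ W' ≤ W, finrank K W' = d := by
  obtain ⟨v, hv⟩ := exists_linearIndependent_of_le_finrank hd
  refine ⟨Submodule.span K (Set.range fun i => (v i : M)), ?_, ?_⟩
  · rw [Submodule.span_le]
    rintro _ ⟨i, rfl⟩
    exact (v i).2
  · have := hv.map' W.subtype W.ker_subtype
    exact (finrank_span_eq_card this).trans (Fintype.card_fin d)

theorem exists_X_mul_of_X_zero_mul_eq {K : Type*} [Field K] {a b : Pxy K}
    (h : X 0 * a = X 1 * b) : ∃ u, a = X 1 * u ∧ b = X 0 * u := by
  have hd : (X 1 : Pxy K) ∣ X 0 * a := ⟨b, h⟩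
  have h01 : ¬ (X 1 : Pxy K) ∣ X 0 := by
    rw [X_dvd_X]; simp
  obtain ⟨u, rfl⟩ := ((X_prime (R := K) (i := (1 : Fin 2))).dvd_or_dvd hd).resolve_left h01
  refine ⟨u, rfl, ?_⟩
  apply mul_left_cancel₀ (X_ne_zero (R := K) (1 : Fin 2))
  rw [← h]; ring

/-- A space of binary forms whose product with the linear forms is as small as possible consists
of all multiples of a fixed polynomial. -/
theorem exists_eq_map_mulLeft {K : Type*} [Field K] (d : ℕ) :
    ∀ V : Submodule K (Pxy K), finrank K V = d + 1 →
      finrank K (V.map (LinearMap.mulLeft K (X 0)) ⊔ V.map (LinearMap.mulLeft K (X 1)) :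
        Submodule K (Pxy K)) ≤ d + 2 →
      ∃ f ≠ 0, V = (homogeneousSubmodule (Fin 2) K d).map (LinearMap.mulLeft K f) := by
  induction d with
  | zero =>
    intro V hV _
    obtain ⟨⟨v, hv⟩, hv0, hspan⟩ := finrank_eq_one_iff'.mp hV
    have hv0' : v ≠ 0 := fun h => hv0 (Subtype.ext h)
    refine ⟨v, hv0', ?_⟩
    ext w
    simp only [Submodule.mem_map, LinearMap.mulLeft_apply]
    constructor
    · intro hw
      obtain ⟨c, hc⟩ := hspan ⟨w, hw⟩
      refine ⟨C c, isHomogeneous_C _ _, ?_⟩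
      rw [mul_comm, ← smul_eq_C_mul]
      exact congrArg Subtype.val hc
    · rintro ⟨p, hp, rfl⟩
      obtain ⟨c, rfl⟩ := exists_eq_C_of_isHomogeneous_zero hp
      rw [mul_comm, ← smul_eq_C_mul]
      exact V.smul_mem _ hv
  | succ d ih =>
    intro V hV hW
    have hX (i : Fin 2) : (X i : Pxy K) ≠ 0 := X_ne_zero i
    have : FiniteDimensional K V := FiniteDimensional.of_finrank_pos (by omega)
    have hsum := Submodule.finrank_sup_add_finrank_inf_eq
      (V.map (LinearMap.mulLeft K (X 0))) (V.map (LinearMap.mulLeft K (X 1)))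
    rw [finrank_map_mulLeft (hX 0), finrank_map_mulLeft (hX 1)] at hsum
    obtain ⟨W, hWle, hWd⟩ := Submodule.exists_le_finrank_eq (d := d + 1)
      (V.map (LinearMap.mulLeft K (X 0)) ⊓ V.map (LinearMap.mulLeft K (X 1)))
      (by have := hsum.symm.le.trans (Nat.add_le_add_right hW _); omega)
    set U : Submodule K (Pxy K) := W.comap (LinearMap.mulLeft K (X 0 * X 1)) with hU
    have hUW : U.map (LinearMap.mulLeft K (X 0 * X 1)) = W := by
      rw [hU, Submodule.map_comap_eq, inf_eq_right]
      intro w hw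
      obtain ⟨⟨a, -, ha⟩, ⟨b, -, hb⟩⟩ := hWle hw
      simp only [LinearMap.mulLeft_apply] at ha hb
      obtain ⟨u, rfl, -⟩ := exists_X_mul_of_X_zero_mul_eq (ha.trans hb.symm)
      exact ⟨u, by rw [← ha, LinearMap.mulLeft_apply, mul_assoc]⟩
    have hUd : finrank K U = d + 1 := by
      rw [← finrank_map_mulLeft (mul_ne_zero (hX 0) (hX 1)), hUW, hWd]
    have hle : U.map (LinearMap.mulLeft K (X 0)) ⊔ U.map (LinearMap.mulLeft K (X 1)) ≤ V := by
      rw [sup_le_iff]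
      constructor
      · rintro _ ⟨u, hu, rfl⟩
        obtain ⟨-, ⟨b, hbV, hb⟩⟩ := hWle hu
        simp only [LinearMap.mulLeft_apply] at hb ⊢
        have : b = X 0 * u := mul_left_cancel₀ (hX 1) (by rw [hb]; ring)
        rwa [← this]
      · rintro _ ⟨u, hu, rfl⟩
        obtain ⟨⟨b, hbV, hb⟩, -⟩ := hWle hu
        simp only [LinearMap.mulLeft_apply] at hb ⊢
        have : b = X 1 * u := mul_left_cancel₀ (hX 0) (by rw [hb]; ring)
        rwa [← this]
    obtain ⟨f, hf, hUf⟩ := ih U hUd ((Submodule.finrank_mono hle).trans hV.le)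
    refine ⟨f, hf, ?_⟩
    symm
    have hsup : (homogeneousSubmodule (Fin 2) K (d + 1)).map (LinearMap.mulLeft K f) =
        U.map (LinearMap.mulLeft K (X 0)) ⊔ U.map (LinearMap.mulLeft K (X 1)) := by
      rw [homogeneousSubmodule_succ, Submodule.map_sup, hUf]
      simp only [← Submodule.map_comp, ← LinearMap.mulLeft_mul, mul_comm]
    apply Submodule.eq_of_le_of_finrank_eq
    · rw [hsup]; exact hle
    · rw [finrank_map_mulLeft hf, finrank_homogeneousSubmodule, hV]

/-- The ideal generated by the multiples `f * g` with `g` a form of degree `a` and by all forms of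
degree `b`. -/
def truncIdeal {K : Type*} [Field K] (a b : ℕ) (f : Pxy K) : Ideal (Pxy K) :=
  Ideal.span ((fun g => f * g) '' (homogeneousSubmodule (Fin 2) K a : Set (Pxy K)) ∪
    (homogeneousSubmodule (Fin 2) K b : Set (Pxy K)))

theorem isHomog_truncIdeal {K : Type*} [Field K] (a b : ℕ) {f : Pxy K} {m : ℕ}
    (hf : f.IsHomogeneous m) : IsHomog (truncIdeal a b f) := by
  let := gradedAlgebra (σ := Fin 2) (R := K)
  have h : (truncIdeal a b f).IsHomogeneous (homogeneousSubmodule (Fin 2) K) := by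
    apply Ideal.homogeneous_span
    rintro _ (⟨g, hg, rfl⟩ | hg)
    · exact ⟨m + a, hf.mul hg⟩
    · exact ⟨b, hg⟩
  exact fun p hp j => homogeneousComponent_mem_of_mem h hp j

theorem truncIdeal_C_mul {K : Type*} [Field K] (a b : ℕ) (f : Pxy K) {c : K} (hc : c ≠ 0) :
    truncIdeal a b (C c * f) = truncIdeal a b f := by
  unfold truncIdeal
  congr 2
  ext p
  constructor
  · rintro ⟨g, hg, rfl⟩
    exact ⟨C c * g, IsHomogeneous.C_mul hg c, by ring⟩
  · rintro ⟨g, hg, rfl⟩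
    refine ⟨C c⁻¹ * g, IsHomogeneous.C_mul hg _, ?_⟩
    have : (C c * C c⁻¹ : Pxy K) = 1 := by rw [← C_mul, mul_inv_cancel₀ hc, C_1]
    linear_combination (f * g) * this

theorem IsLinChange.map_homogeneousSubmodule {K : Type*} [Field K] {φ : Pxy K ≃ₐ[K] Pxy K}
    (hφ : IsLinChange φ) (j : ℕ) :
    (homogeneousSubmodule (Fin 2) K j).map (φ.toLinearEquiv : Pxy K →ₗ[K] Pxy K) =
      homogeneousSubmodule (Fin 2) K j := by
  apply Submodule.eq_of_le_of_finrank_eq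
  · rintro _ ⟨p, hp, rfl⟩
    have h := IsHomogeneous.aeval hp (fun i => φ (X i)) hφ
    rw [one_mul] at h
    have : φ p = aeval (fun i => φ (X i)) p :=
      DFunLike.congr_fun (aeval_unique φ.toAlgHom) p
    change (φ p).IsHomogeneous j
    rwa [this]
  · exact LinearEquiv.finrank_map_eq φ.toLinearEquiv _

theorem map_truncIdeal {K : Type*} [Field K] {φ : Pxy K ≃ₐ[K] Pxy K} (hφ : IsLinChange φ)
    (a b : ℕ) (f : Pxy K) : Ideal.map φ (truncIdeal a b f) = truncIdeal a b (φ f) := by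
  have himg (j : ℕ) : φ '' (homogeneousSubmodule (Fin 2) K j : Set (Pxy K)) =
      homogeneousSubmodule (Fin 2) K j :=
    congrArg SetLike.coe (hφ.map_homogeneousSubmodule j)
  unfold truncIdeal
  rw [Ideal.map_span, Set.image_union, himg b, Set.image_image]
  congr 2
  simp only [map_mul]
  rw [← Set.image_image (fun x => φ f * x) φ, himg a]

theorem finrank_inf_add_hilb {K : Type*} [Field K] (I : Ideal (Pxy K)) (j : ℕ) :
    finrank K (homogeneousSubmodule (Fin 2) K j ⊓ I.restrictScalars K : Submodule K (Pxy K)) +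
      hilb K I j = j + 1 := by
  have h := Submodule.finrank_quotient_add_finrank
    (Submodule.comap (homogeneousSubmodule (Fin 2) K j).subtype (I.restrictScalars K))
  rw [finrank_homogeneousSubmodule] at h
  rw [← h, hilb, ← Submodule.map_comap_subtype, add_comm]
  congr 1
  exact (LinearEquiv.finrank_eq (Submodule.equivMapOfInjective _
    (Submodule.subtype_injective _) _)).symm

theorem isHomogeneous_of_mul_X_pow {K : Type*} [Field K] {f : Pxy K} {m d : ℕ}
    (h : (f * X 0 ^ d).IsHomogeneous (m + d)) : f.IsHomogeneous m := by
  intro e he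
  have hc : coeff (e + Finsupp.single 0 d) (f * X 0 ^ d) ≠ 0 := by
    rw [X_pow_eq_monomial, coeff_mul_monomial, mul_one]
    exact he
  have := h hc
  rw [map_add, Finsupp.weight_single] at this
  simpa using this

theorem map_mulLeft_le_of_le {K : Type*} [Field K] {I : Ideal (Pxy K)} {f : Pxy K} {a : ℕ}
    (h : (homogeneousSubmodule (Fin 2) K a).map (LinearMap.mulLeft K f) ≤ I.restrictScalars K)
    {j : ℕ} (hj : a ≤ j) :
    (homogeneousSubmodule (Fin 2) K j).map (LinearMap.mulLeft K f) ≤ I.restrictScalars K := by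
  induction j, hj using Nat.le_induction with
  | base => exact h
  | succ j _ ih =>
    rw [homogeneousSubmodule_succ, Submodule.map_sup, sup_le_iff]
    constructor <;>
    · rintro _ ⟨_, ⟨p, hp, rfl⟩, rfl⟩
      simp only [LinearMap.mulLeft_apply, Submodule.restrictScalars_mem]
      rw [mul_left_comm]
      exact I.mul_mem_left _ (ih ⟨p, hp, rfl⟩)

theorem mul_mem_truncIdeal {K : Type*} [Field K] {a b : ℕ} {f g : Pxy K} {j : ℕ} (hj : a ≤ j)
    (hg : g.IsHomogeneous j) : f * g ∈ truncIdeal a b f := by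
  refine map_mulLeft_le_of_le (I := truncIdeal a b f) (a := a) ?_ hj ⟨g, hg, rfl⟩
  rintro _ ⟨p, hp, rfl⟩
  exact Ideal.subset_span (Or.inl ⟨p, hp, rfl⟩)

theorem isHomogeneous_mem_truncIdeal {K : Type*} [Field K] {a b : ℕ} {f g : Pxy K} {j : ℕ}
    (hj : b ≤ j) (hg : g.IsHomogeneous j) : g ∈ truncIdeal a b f := by
  have h := map_mulLeft_le_of_le (I := truncIdeal a b f) (f := 1) (a := b) ?_ hj ⟨g, hg, rfl⟩
  · simpa using h
  · rintro _ ⟨p, hp, rfl⟩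
    rw [LinearMap.mulLeft_apply, one_mul]
    exact Ideal.subset_span (Or.inr hp)

/-- A homogeneous ideal with Hilbert function `(1, 2, …, n, s, …, s)` is determined by a form of
degree `s`. -/
theorem exists_eq_truncIdeal {K : Type*} [Field K] {n k s : ℕ} (hk : 1 ≤ k) (hsn : s ≤ n)
    {I : Ideal (Pxy K)} (hI : IsHomog I)
    (ht : ∀ j, hilb K I j = if j < n then j + 1 else if j ≤ n + k then s else 0) :
    ∃ f : Pxy K, f ≠ 0 ∧ f.IsHomogeneous s ∧ I = truncIdeal (n - s) (n + k + 1) f := by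
  obtain ⟨d, rfl⟩ := Nat.exists_eq_add_of_le hsn
  set V : ℕ → Submodule K (Pxy K) :=
    fun j => homogeneousSubmodule (Fin 2) K j ⊓ I.restrictScalars K with hV
  have hdim (j : ℕ) : finrank K (V j) + hilb K I j = j + 1 := finrank_inf_add_hilb I j
  have hfin (j : ℕ) : FiniteDimensional K (V j) :=
    Submodule.finiteDimensional_of_le (inf_le_left : V j ≤ homogeneousSubmodule (Fin 2) K j)
  have hlow {j : ℕ} (hj : j < s + d) : V j = ⊥ := by
    have := hdim j
    rw [ht, if_pos hj] at this
    exact Submodule.finrank_eq_zero.mp (by omega)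
  have hmid {j : ℕ} (hj : s + d ≤ j) (hj' : j ≤ s + d + k) : finrank K (V j) + s = j + 1 := by
    have := hdim j
    rwa [ht, if_neg (by omega), if_pos hj'] at this
  have hhigh {j : ℕ} (hj : s + d + k < j) : V j = homogeneousSubmodule (Fin 2) K j := by
    have := hdim j
    rw [ht, if_neg (by omega), if_neg (by omega)] at this
    apply Submodule.eq_of_le_of_finrank_eq inf_le_left
    rw [finrank_homogeneousSubmodule]
    omega
  have hsup : (V (s + d)).map (LinearMap.mulLeft K (X 0)) ⊔
      (V (s + d)).map (LinearMap.mulLeft K (X 1)) ≤ V (s + d + 1) := by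
    rw [sup_le_iff]
    constructor <;>
    · rintro _ ⟨p, ⟨hp, hpI⟩, rfl⟩
      refine ⟨?_, I.mul_mem_left _ hpI⟩
      rw [add_comm]
      exact (isHomogeneous_X K _).mul hp
  have hdim_succ : finrank K (V (s + d + 1)) = d + 2 := by
    have := hmid (j := s + d + 1) (by omega) (by omega)
    omega
  obtain ⟨f, hf, hVf⟩ := exists_eq_map_mulLeft d (V (s + d))
    (by have := hmid le_rfl (by omega); omega)
    ((Submodule.finrank_mono hsup).trans
      hdim_succ.le)
  have hfI : (homogeneousSubmodule (Fin 2) K d).map (LinearMap.mulLeft K f) ≤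
      I.restrictScalars K := hVf ▸ inf_le_right
  have hfs : f.IsHomogeneous s := by
    apply isHomogeneous_of_mul_X_pow (d := d)
    have : f * X 0 ^ d ∈ V (s + d) := by
      rw [hVf]
      exact ⟨X 0 ^ d, isHomogeneous_X_pow _ _, rfl⟩
    exact this.1
  refine ⟨f, hf, hfs, ?_⟩
  rw [Nat.add_sub_cancel_left]
  apply le_antisymm
  · intro p hp
    rw [← sum_homogeneousComponent p]
    refine Ideal.sum_mem _ fun j _ => ?_
    have hj : homogeneousComponent j p ∈ V j :=
      ⟨homogeneousComponent_isHomogeneous j p, hI p hp j⟩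
    rcases lt_or_ge j (s + d) with h1 | h1
    · rw [hlow h1, Submodule.mem_bot] at hj
      rw [hj]
      exact Ideal.zero_mem _
    rcases lt_or_ge (s + d + k) j with h2 | h2
    · exact isHomogeneous_mem_truncIdeal h2 hj.1
    obtain ⟨i, rfl⟩ := Nat.exists_eq_add_of_le (show s ≤ j by omega)
    have hVj : (homogeneousSubmodule (Fin 2) K i).map (LinearMap.mulLeft K f) = V (s + i) := by
      apply Submodule.eq_of_le_of_finrank_eq
      · refine le_inf ?_ (map_mulLeft_le_of_le hfI (by omega))
        rintro _ ⟨q, hq, rfl⟩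
        exact hfs.mul hq
      · rw [finrank_map_mulLeft hf, finrank_homogeneousSubmodule]
        have : finrank K (V (s + i)) = i + 1 := by
          have := hmid h1 h2
          omega
        exact this.symm
    rw [← hVj] at hj
    obtain ⟨q, hq, hqj⟩ := hj
    rw [← hqj]
    exact mul_mem_truncIdeal (by omega) hq
  · unfold truncIdeal
    rw [Ideal.span_le]
    rintro _ (⟨g, hg, rfl⟩ | hg)
    · exact hfI ⟨g, hg, rfl⟩
    · rw [← hhigh (by omega)] at hg
      exact hg.2

theorem IsHomogeneous.eval_smul {K : Type*} [Field K] {f : Pxy K} {d : ℕ}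
    (hf : f.IsHomogeneous d) (c : K) (v : Fin 2 → K) :
    eval (c • v) f = c ^ d * eval v f := by
  rw [eval_eq, eval_eq, Finset.mul_sum]
  refine Finset.sum_congr rfl fun e he => ?_
  have hd : ∑ i ∈ e.support, e i = d := (hf.degree_eq_sum_deg_support he).symm
  simp only [Pi.smul_apply, smul_eq_mul, mul_pow, Finset.prod_mul_distrib,
    Finset.prod_pow_eq_pow_sum, hd]
  ring

/-- The linear form `a x + b y`. -/
def linForm {K : Type*} [Field K] (a b : K) : Pxy K := C a * X 0 + C b * X 1

theorem isHomogeneous_linForm {K : Type*} [Field K] (a b : K) :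
    (linForm a b).IsHomogeneous 1 :=
  (isHomogeneous_C_mul_X a 0).add (isHomogeneous_C_mul_X b 1)

theorem exists_eval_eq_zero {K : Type*} [Field K] [IsAlgClosed K] {f : Pxy K} {d : ℕ}
    (hf : f.IsHomogeneous (d + 1)) : ∃ v : Fin 2 → K, v ≠ 0 ∧ eval v f = 0 := by
  set P : Polynomial K := aeval ![Polynomial.X, 1] f with hP
  have hPe (t : K) : P.eval t = eval ![t, 1] f := by
    have : (Polynomial.aeval t).comp (aeval ![Polynomial.X, (1 : Polynomial K)]) =
        (aeval ![t, 1] : Pxy K →ₐ[K] K) := by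
      ext i
      fin_cases i <;> simp
    have := DFunLike.congr_fun this f
    simpa [Polynomial.coe_aeval_eq_eval, coe_aeval_eq_eval] using this
  by_cases hdeg : P.degree = 0
  · obtain ⟨c, hc⟩ : ∃ c, P = Polynomial.C c :=
      ⟨_, Polynomial.eq_C_of_degree_eq_zero hdeg⟩
    have key : X 1 * (f - C c * X 1 ^ (d + 1)) = 0 := by
      have : Infinite K := IsAlgClosed.instInfinite
      apply MvPolynomial.funext
      intro v
      by_cases hv : v 1 = 0
      · simp [hv]
      have hve : v = v 1 • ![v 0 / v 1, 1] := by
        ext i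
        fin_cases i
        · simp [mul_div_cancel₀ _ hv]
        · simp
      have : eval v f = v 1 ^ (d + 1) * c := by
        conv_lhs => rw [hve, IsHomogeneous.eval_smul hf, ← hPe, hc, Polynomial.eval_C]
      simp [this, mul_comm]
    have hfe : f = C c * X 1 ^ (d + 1) :=
      sub_eq_zero.mp ((mul_eq_zero.mp key).resolve_left (X_ne_zero _))
    refine ⟨![1, 0], fun h => one_ne_zero (congrFun h 0), ?_⟩
    simp [hfe]
  · obtain ⟨t, ht⟩ := IsAlgClosed.exists_root P hdeg
    exact ⟨![t, 1], fun h => one_ne_zero (congrFun h 1), by rw [← hPe]; exact ht⟩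

theorem exists_eq_linForm_mul {K : Type*} [Field K] [IsAlgClosed K] {f : Pxy K} {d : ℕ}
    (hf : f.IsHomogeneous (d + 1)) :
    ∃ a b : K, ∃ g : Pxy K, g.IsHomogeneous d ∧ f = linForm a b * g := by
  obtain ⟨v, hv, hfv⟩ := exists_eval_eq_zero hf
  set E : Submodule K (Pxy K) :=
    homogeneousSubmodule (Fin 2) K (d + 1) ⊓ LinearMap.ker (aeval v).toLinearMap with hE
  have hl : linForm (v 1) (-v 0) ≠ 0 := by
    intro h
    apply hv
    have h0 := congrArg (eval ![1, 0]) h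
    have h1 := congrArg (eval ![0, 1]) h
    simp only [linForm, map_add, map_mul, eval_C, eval_X, map_zero] at h0 h1
    ext i
    fin_cases i
    · simpa using h1
    · simpa using h0
  have hlt : E < homogeneousSubmodule (Fin 2) K (d + 1) := by
    apply lt_of_le_of_ne inf_le_left
    intro h
    apply hv
    ext i
    have hX : (X i ^ (d + 1) : Pxy K) ∈ E := by
      rw [hE, h]; exact isHomogeneous_X_pow _ _
    simpa using hX.2
  have hlt' := Submodule.finrank_lt_finrank_of_lt hlt
  rw [finrank_homogeneousSubmodule] at hlt'
  have : FiniteDimensional K E := Submodule.finiteDimensional_of_le hlt.le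
  have hmap : (homogeneousSubmodule (Fin 2) K d).map
      (LinearMap.mulLeft K (linForm (v 1) (-v 0))) = E := by
    apply Submodule.eq_of_le_of_finrank_le
    · rintro _ ⟨g, hg, rfl⟩
      refine ⟨?_, ?_⟩
      · rw [add_comm]
        exact (isHomogeneous_linForm _ _).mul hg
      · simp only [linForm, LinearMap.mulLeft_apply, SetLike.mem_coe, LinearMap.mem_ker,
          AlgHom.toLinearMap_apply, map_mul, map_add, aeval_X, algHom_C]
        simp [mul_comm (v 0)]
    · rw [finrank_map_mulLeft hl, finrank_homogeneousSubmodule]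
      omega
  have hfE : f ∈ E := ⟨hf, by simpa [coe_aeval_eq_eval] using hfv⟩
  rw [← hmap] at hfE
  obtain ⟨g, hg, rfl⟩ := hfE
  exact ⟨_, _, g, hg, rfl⟩

theorem exists_isLinChange {K : Type*} [Field K] {a b c d : K} (h : a * d - b * c ≠ 0) :
    ∃ φ : Pxy K ≃ₐ[K] Pxy K, IsLinChange φ ∧
      φ (linForm a b) = X 0 ∧ φ (linForm c d) = X 1 := by
  set D := a * d - b * c with hD
  have hDC : (C D⁻¹ * (C a * C d - C b * C c) : Pxy K) = 1 := by
    rw [← C_mul, ← C_mul, ← C_sub, ← C_mul, ← hD, inv_mul_cancel₀ h, C_1]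
  set F : Pxy K →ₐ[K] Pxy K :=
    aeval ![linForm (D⁻¹ * d) (-(D⁻¹ * b)), linForm (-(D⁻¹ * c)) (D⁻¹ * a)] with hF
  set G : Pxy K →ₐ[K] Pxy K := aeval ![linForm a b, linForm c d] with hG
  have h0 : F (linForm a b) = X 0 := by
    simp only [hF, linForm, map_add, map_mul, map_neg, aeval_X, algHom_C, algebraMap_eq,
      Matrix.cons_val_zero, Matrix.cons_val_one]
    linear_combination X 0 * hDC
  have h1 : F (linForm c d) = X 1 := by
    simp only [hF, linForm, map_add, map_mul, map_neg, aeval_X, algHom_C, algebraMap_eq,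
      Matrix.cons_val_zero, Matrix.cons_val_one]
    linear_combination X 1 * hDC
  refine ⟨AlgEquiv.ofAlgHom F G ?_ ?_, ?_, h0, h1⟩
  · ext i : 1
    fin_cases i
    · simpa [hG] using h0
    · simpa [hG] using h1
  · ext i : 1
    fin_cases i
    · simp only [hF, hG, linForm, AlgHom.comp_apply, map_add, map_mul, map_neg, aeval_X, algHom_C,
        algebraMap_eq, Matrix.cons_val_zero, Matrix.cons_val_one, Fin.zero_eta, AlgHom.id_apply]
      linear_combination X 0 * hDC
    · simp only [hF, hG, linForm, AlgHom.comp_apply, map_add, map_mul, map_neg, aeval_X, algHom_C,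
        algebraMap_eq, Matrix.cons_val_zero, Matrix.cons_val_one, Fin.mk_one, AlgHom.id_apply]
      linear_combination X 1 * hDC
  · intro i
    change (F (X i)).IsHomogeneous 1
    rw [hF, aeval_X]
    fin_cases i
    · exact isHomogeneous_linForm (D⁻¹ * d) (-(D⁻¹ * b))
    · exact isHomogeneous_linForm (-(D⁻¹ * c)) (D⁻¹ * a)

theorem linForm_zero {K : Type*} [Field K] : linForm (0 : K) 0 = 0 := by
  simp [linForm]

theorem C_mul_linForm {K : Type*} [Field K] (t a b : K) :
    C t * linForm a b = linForm (t * a) (t * b) := by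
  simp only [linForm, C_mul]
  ring

theorem exists_linForm_eq_C_mul {K : Type*} [Field K] {a b c d : K} (h0 : linForm a b ≠ 0)
    (h : a * d - b * c = 0) : ∃ t, linForm c d = C t * linForm a b := by
  by_cases ha : a = 0
  · have hb : b ≠ 0 := by
      rintro rfl
      exact h0 (by rw [ha, linForm_zero])
    have hc : c = 0 := by simpa [ha, hb] using h
    refine ⟨d / b, ?_⟩
    rw [C_mul_linForm, ha, hc, mul_zero, div_mul_cancel₀ _ hb]
  · refine ⟨c / a, ?_⟩
    rw [C_mul_linForm, div_mul_cancel₀ _ ha]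
    congr 1
    field_simp
    linear_combination h

theorem exists_linForm_eq_add {K : Type*} [Field K] {a b c d : K} (h : a * d - b * c ≠ 0)
    (e f : K) : ∃ α β, linForm e f = C α * linForm a b + C β * linForm c d := by
  refine ⟨(e * d - f * c) / (a * d - b * c), (a * f - b * e) / (a * d - b * c), ?_⟩
  have hsum {p q r s : K} : linForm p q + linForm r s = linForm (p + r) (q + s) := by
    simp only [linForm, C_add]
    ring
  rw [C_mul_linForm, C_mul_linForm, hsum]
  congr 1 <;>
  · rw [div_mul_eq_mul_div, div_mul_eq_mul_div, ← add_div, eq_div_iff h]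
    ring

/-- Representatives of the binary forms of degree at most three up to scalars and linear changes
of variables. -/
def normalForms (K : Type*) [Field K] : Set (Pxy K) :=
  {X 0, X 0 ^ 2, X 0 * X 1, X 0 ^ 3, X 0 ^ 2 * X 1, X 0 * X 1 * (X 0 + X 1)}

theorem exists_isHomogeneous_of_mem_normalForms {K : Type*} [Field K] {g : Pxy K}
    (hg : g ∈ normalForms K) : ∃ m, g.IsHomogeneous m := by
  have hX (i : Fin 2) : (X i : Pxy K).IsHomogeneous 1 := isHomogeneous_X K i
  rcases hg with rfl | rfl | rfl | rfl | rfl | rfl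
  · exact ⟨_, hX 0⟩
  · exact ⟨_, (hX 0).pow 2⟩
  · exact ⟨_, (hX 0).mul (hX 1)⟩
  · exact ⟨_, (hX 0).pow 3⟩
  · exact ⟨_, ((hX 0).pow 2).mul (hX 1)⟩
  · exact ⟨_, ((hX 0).mul (hX 1)).mul ((hX 0).add (hX 1))⟩

/-- The form `f` becomes a scalar multiple of a normal form after a linear change of variables. -/
def HasNormalForm {K : Type*} [Field K] (f : Pxy K) : Prop :=
  ∃ φ : Pxy K ≃ₐ[K] Pxy K, IsLinChange φ ∧ ∃ c : K, c ≠ 0 ∧ ∃ g ∈ normalForms K, φ f = C c * g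

theorem HasNormalForm.C_mul {K : Type*} [Field K] {f : Pxy K} (hf : HasNormalForm f) {c : K}
    (hc : c ≠ 0) : HasNormalForm (C c * f) := by
  obtain ⟨φ, hφ, c', hc', g, hg, hfg⟩ := hf
  refine ⟨φ, hφ, c * c', mul_ne_zero hc hc', g, hg, ?_⟩
  rw [map_mul, hfg, MvPolynomial.C_mul, mul_assoc]
  congr 1
  exact AlgEquiv.commutes φ c

theorem HasNormalForm.of_eq {K : Type*} [Field K] {f g : Pxy K} {φ : Pxy K ≃ₐ[K] Pxy K}
    (hφ : IsLinChange φ) (hg : g ∈ normalForms K) (h : φ f = g) : HasNormalForm f :=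
  ⟨φ, hφ, 1, one_ne_zero, g, hg, by rw [h, C_1, one_mul]⟩

theorem exists_isLinChange_linForm {K : Type*} [Field K] {a b : K} (h : linForm a b ≠ 0) :
    ∃ φ : Pxy K ≃ₐ[K] Pxy K, IsLinChange φ ∧ φ (linForm a b) = X 0 := by
  by_cases ha : a = 0
  · have hb : b ≠ 0 := by
      rintro rfl
      exact h (by rw [ha, linForm_zero])
    obtain ⟨φ, hφ, h0, -⟩ := exists_isLinChange (a := a) (b := b) (c := 1) (d := 0)
      (by simpa using hb)
    exact ⟨φ, hφ, h0⟩
  · obtain ⟨φ, hφ, h0, -⟩ := exists_isLinChange (a := a) (b := b) (c := 0) (d := 1)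
      (by simpa using ha)
    exact ⟨φ, hφ, h0⟩

theorem hasNormalForm_linForm_mul {K : Type*} [Field K] {a b c d : K} (h1 : linForm a b ≠ 0)
    (h2 : linForm c d ≠ 0) : HasNormalForm (linForm a b * linForm c d) := by
  by_cases h : a * d - b * c = 0
  · obtain ⟨t, ht⟩ := exists_linForm_eq_C_mul h1 h
    have ht0 : t ≠ 0 := by
      rintro rfl
      exact h2 (by simpa using ht)
    obtain ⟨φ, hφ, h0⟩ := exists_isLinChange_linForm h1
    rw [ht, mul_left_comm]
    refine HasNormalForm.C_mul (.of_eq (g := X 0 ^ 2) hφ (by simp [normalForms]) ?_) ht0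
    rw [map_mul, h0, sq]
  · obtain ⟨φ, hφ, h0, h1⟩ := exists_isLinChange h
    exact .of_eq (g := X 0 * X 1) hφ (by simp [normalForms]) (by rw [map_mul, h0, h1])

theorem hasNormalForm_linForm_sq_mul {K : Type*} [Field K] {a b c d : K}
    (h1 : linForm a b ≠ 0) (h2 : linForm c d ≠ 0) :
    HasNormalForm (linForm a b ^ 2 * linForm c d) := by
  by_cases h : a * d - b * c = 0
  · obtain ⟨t, ht⟩ := exists_linForm_eq_C_mul h1 h
    have ht0 : t ≠ 0 := by
      rintro rfl
      exact h2 (by simpa using ht)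
    obtain ⟨φ, hφ, h0⟩ := exists_isLinChange_linForm h1
    rw [ht, mul_left_comm, ← pow_succ]
    refine HasNormalForm.C_mul (.of_eq (g := X 0 ^ 3) hφ (by simp [normalForms]) ?_) ht0
    rw [map_pow, h0]
  · obtain ⟨φ, hφ, h0, h1⟩ := exists_isLinChange h
    exact .of_eq (g := X 0 ^ 2 * X 1) hφ (by simp [normalForms])
      (by rw [map_mul, map_pow, h0, h1])

theorem hasNormalForm_linForm_mul_mul {K : Type*} [Field K] {a b c d e f : K}
    (h1 : linForm a b ≠ 0) (h2 : linForm c d ≠ 0) (h3 : linForm e f ≠ 0) :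
    HasNormalForm (linForm a b * linForm c d * linForm e f) := by
  by_cases h : a * d - b * c = 0
  · obtain ⟨t, ht⟩ := exists_linForm_eq_C_mul h1 h
    have ht0 : t ≠ 0 := by
      rintro rfl
      exact h2 (by simpa using ht)
    have := (hasNormalForm_linForm_sq_mul h1 h3).C_mul ht0
    rw [ht]
    convert this using 1
    ring
  obtain ⟨α, β, hαβ⟩ := exists_linForm_eq_add h e f
  by_cases hα : α = 0
  · have hβ : β ≠ 0 := by
      rintro rfl
      exact h3 (by simpa [hα] using hαβ)
    have := (hasNormalForm_linForm_sq_mul h2 h1).C_mul hβ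
    rw [hαβ, hα, C_0]
    convert this using 1
    ring
  by_cases hβ : β = 0
  · have := (hasNormalForm_linForm_sq_mul h1 h2).C_mul hα
    rw [hαβ, hβ, C_0]
    convert this using 1
    ring
  have hdet : α * a * (β * d) - α * b * (β * c) ≠ 0 := by
    have : α * a * (β * d) - α * b * (β * c) = α * β * (a * d - b * c) := by ring
    rw [this]
    exact mul_ne_zero (mul_ne_zero hα hβ) h
  obtain ⟨φ, hφ, h0, h1⟩ := exists_isLinChange hdet
  rw [← C_mul_linForm] at h0 h1
  have key : HasNormalForm ((C α * linForm a b) * (C β * linForm c d) *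
      (C α * linForm a b + C β * linForm c d)) :=
    .of_eq (g := X 0 * X 1 * (X 0 + X 1)) hφ (by simp [normalForms])
      (by rw [map_mul, map_mul, map_add, h0, h1])
  have := key.C_mul (inv_ne_zero (mul_ne_zero hα hβ))
  convert this using 1
  have hC : (C (α * β)⁻¹ * (C α * C β) : Pxy K) = 1 := by
    rw [← MvPolynomial.C_mul, ← MvPolynomial.C_mul, inv_mul_cancel₀ (mul_ne_zero hα hβ), C_1]
  rw [hαβ]
  linear_combination (-(linForm a b * linForm c d *
    (C α * linForm a b + C β * linForm c d))) * hC

theorem hasNormalForm_of_isHomogeneous {K : Type*} [Field K] [IsAlgClosed K] {f : Pxy K} {s : ℕ}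
    (hs1 : 1 ≤ s) (hs3 : s ≤ 3) (hf : f.IsHomogeneous s) (hf0 : f ≠ 0) : HasNormalForm f := by
  interval_cases s
  · obtain ⟨a, b, g, hg, rfl⟩ := exists_eq_linForm_mul hf
    obtain ⟨c, rfl⟩ := exists_eq_C_of_isHomogeneous_zero hg
    simp only [ne_eq, mul_eq_zero, not_or, C_eq_zero] at hf0
    obtain ⟨φ, hφ, h0⟩ := exists_isLinChange_linForm hf0.1
    rw [mul_comm]
    exact HasNormalForm.C_mul (.of_eq hφ (by simp [normalForms]) h0) hf0.2
  · obtain ⟨a, b, g, hg, rfl⟩ := exists_eq_linForm_mul hf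
    obtain ⟨a', b', g', hg', rfl⟩ := exists_eq_linForm_mul hg
    obtain ⟨c, rfl⟩ := exists_eq_C_of_isHomogeneous_zero hg'
    simp only [ne_eq, mul_eq_zero, not_or, C_eq_zero] at hf0
    rw [← mul_assoc, mul_comm]
    exact (hasNormalForm_linForm_mul hf0.1 hf0.2.1).C_mul hf0.2.2
  · obtain ⟨a, b, g, hg, rfl⟩ := exists_eq_linForm_mul hf
    obtain ⟨a', b', g', hg', rfl⟩ := exists_eq_linForm_mul hg
    obtain ⟨a'', b'', g'', hg'', rfl⟩ := exists_eq_linForm_mul hg'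
    obtain ⟨c, rfl⟩ := exists_eq_C_of_isHomogeneous_zero hg''
    simp only [ne_eq, mul_eq_zero, not_or, C_eq_zero] at hf0
    rw [← mul_assoc, ← mul_assoc, mul_comm]
    exact (hasNormalForm_linForm_mul_mul hf0.1 hf0.2.1 hf0.2.2.1).C_mul hf0.2.2.2

/-- The sequence `(1, 2, …, n, s, s, …, s)` with `s ≤ 3` is of homogeneous
finite type (types T₅, T₆, T₈). -/
theorem stmt10 (K : Type*) [Field K] [IsAlgClosed K] [CharZero K]
    (n k s : ℕ) (hn : 2 ≤ n) (hk : 1 ≤ k) (hs1 : 1 ≤ s) (hs3 : s ≤ 3) (hsn : s ≤ n) :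
    HomogFiniteType K
      (fun j => if j < n then j + 1 else if j ≤ n + k then s else 0) := by
  refine ⟨truncIdeal (n - s) (n + k + 1) '' normalForms K, ?_, ?_, ?_⟩
  · exact Set.Finite.image _ (by simp [normalForms])
  · rintro _ ⟨g, hg, rfl⟩
    obtain ⟨m, hm⟩ := exists_isHomogeneous_of_mem_normalForms hg
    exact isHomog_truncIdeal _ _ hm
  · intro I hI ht
    obtain ⟨f, hf0, hf, rfl⟩ := exists_eq_truncIdeal hk hsn hI ht
    obtain ⟨φ, hφ, c, hc, g, hg, hfg⟩ := hasNormalForm_of_isHomogeneous hs1 hs3 hf hf0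
    refine ⟨φ, hφ, g, hg, ?_⟩
    rw [map_truncIdeal hφ, hfg, truncIdeal_C_mul _ _ _ hc]
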